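/- Let M, N ∈ f.d. k(Γ,Λ) be indecomposable modules. If M is preprojective and dim M = dim N (equality of dimension vectors), then M ≅ N. -/

import Mathlib

namespace KP

/-! ## Quivers on a fixed vertex set `Fin n`.

An orientation is encoded by `Λ : Fin n → Fin n → ℕ`, where `Λ a b` is the number of
arrows from `a` to `b`.  The underlying graph is recorded by `edges Λ a b = Λ a b + Λ b a`. -/

/-- The orientation `σ_x Λ` obtained by reversing every arrow incident with `x`. -/
def flipO {n : ℕ} (x : Fin n) (Λ : Fin n → Fin n → ℕ) : Fin n → Fin n → ℕ :=
  fun a b => if a = x ∨ b = x then Λ b a else Λ a b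

/-- Number of edges of the underlying graph joining `a` and `b`. -/
def edges {n : ℕ} (Λ : Fin n → Fin n → ℕ) (a b : Fin n) : ℕ := Λ a b + Λ b a

/-- `x` is a sink: no arrow starts at `x`. -/
def IsSink {n : ℕ} (Λ : Fin n → Fin n → ℕ) (x : Fin n) : Prop := ∀ y, Λ x y = 0

/-- `S` is a `(+)`-admissible sequence of vertices on `(Γ, Λ)`. -/
def Admissible {n : ℕ} (Λ : Fin n → Fin n → ℕ) : List (Fin n) → Prop
  | [] => True
  | x :: xs => IsSink Λ x ∧ Admissible (flipO x Λ) xs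

/-- The orientation `Λ^S`. -/
def orientAfter {n : ℕ} (Λ : Fin n → Fin n → ℕ) : List (Fin n) → (Fin n → Fin n → ℕ)
  | [] => Λ
  | x :: xs => orientAfter (flipO x Λ) xs

/-- Elementary move: interchange two consecutive vertices not joined by an edge. -/
inductive SwapRel {n : ℕ} (E : Fin n → Fin n → ℕ) : List (Fin n) → List (Fin n) → Prop
  | swap (l₁ l₂ : List (Fin n)) (a b : Fin n) (h : E a b = 0) :
      SwapRel E (l₁ ++ a :: b :: l₂) (l₁ ++ b :: a :: l₂)

/-- The equivalence `∼` on sequences of vertices: reflexive–transitive closure of the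
(symmetric) relation `SwapRel`. -/
def Sim {n : ℕ} (E : Fin n → Fin n → ℕ) : List (Fin n) → List (Fin n) → Prop :=
  Relation.ReflTransGen (SwapRel E)

/-- The preorder `S ⪯ T` : `T ∼ S ++ U` for some `(+)`-admissible sequence `U` on `(Γ, Λ^S)`. -/
def Preceq {n : ℕ} (Λ : Fin n → Fin n → ℕ) (S T : List (Fin n)) : Prop :=
  ∃ U, Admissible (orientAfter Λ S) U ∧ Sim (edges Λ) T (S ++ U)

/-- Support of a sequence of vertices. -/
def suppOf {n : ℕ} (S : List (Fin n)) : Set (Fin n) := {v | v ∈ S}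

/-- The partial order on vertices: `x ≤ y` iff there is a path from `x` to `y` in `(Γ, Λ)`. -/
def PathLE {n : ℕ} (Λ : Fin n → Fin n → ℕ) (x y : Fin n) : Prop :=
  Relation.ReflTransGen (fun a b => Λ a b ≠ 0) x y

/-- A filter (up-closed set) of the poset `(Γ₀, Λ)`. -/
def IsFilter {n : ℕ} (Λ : Fin n → Fin n → ℕ) (F : Set (Fin n)) : Prop :=
  ∀ x ∈ F, ∀ y, PathLE Λ x y → y ∈ F

/-- The principal filter `⟨x⟩`. -/
def upSet {n : ℕ} (Λ : Fin n → Fin n → ℕ) (x : Fin n) : Set (Fin n) := {y | PathLE Λ x y}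

/-- The hull `H_Λ(F)`: the smallest filter containing `F` and every vertex joined
by an edge to a vertex of `F`. -/
def hull {n : ℕ} (Λ : Fin n → Fin n → ℕ) (F : Set (Fin n)) : Set (Fin n) :=
  {y | ∃ x, (x ∈ F ∨ ∃ z ∈ F, edges Λ z x ≠ 0) ∧ PathLE Λ x y}

/-- `segs` is a canonical form of `S` (Proposition 2.1): `S ∼ S₁S₂⋯S_r`, each segment
consists of distinct vertices, is nonempty, and `Supp S_i = Supp (S_i S_{i+1} ⋯ S_r)`. -/
def Segments {n : ℕ} (Λ : Fin n → Fin n → ℕ) (S : List (Fin n))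
    (segs : List (List (Fin n))) : Prop :=
  Admissible Λ segs.flatten ∧ Sim (edges Λ) S segs.flatten ∧
  (∀ seg ∈ segs, seg ≠ [] ∧ seg.Nodup) ∧
  ∀ i, i < segs.length → suppOf (segs.getD i []) = suppOf ((segs.drop i).flatten)

/-- `J` is (a representative of) the join `S ∨ T` (Definition 2.4):  the canonical form of `J`
has `Supp R_i = Supp S_i ∪ Supp T_i` (out-of-range segments read as `∅`). -/
def IsJoin {n : ℕ} (Λ : Fin n → Fin n → ℕ) (S T J : List (Fin n)) : Prop :=
  ∃ CS CT CJ, Segments Λ S CS ∧ Segments Λ T CT ∧ Segments Λ J CJ ∧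
    ∀ i, suppOf (CJ.getD i []) = suppOf (CS.getD i []) ∪ suppOf (CT.getD i [])

/-- `M` is (a representative of) the meet `S ∧ T` (Definition 2.4). -/
def IsMeet {n : ℕ} (Λ : Fin n → Fin n → ℕ) (S T M : List (Fin n)) : Prop :=
  ∃ CS CT CM, Segments Λ S CS ∧ Segments Λ T CT ∧ Segments Λ M CM ∧
    ∀ i, suppOf (CM.getD i []) = suppOf (CS.getD i []) ∩ suppOf (CT.getD i [])

/-- `S` is (equivalent to) the join `T₁ ∨ ⋯ ∨ T_l` of the list of sequences `Ts`. -/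
def IsJoinList {n : ℕ} (Λ : Fin n → Fin n → ℕ) : List (List (Fin n)) → List (Fin n) → Prop
  | [], S => S = []
  | T :: Ts, S => ∃ J, IsJoinList Λ Ts J ∧ IsJoin Λ T J S

/-- The segments of a canonical form of a principal sequence `S_{r,x}` (Definition 3.1). -/
def PrincipalSegs {n : ℕ} (Λ : Fin n → Fin n → ℕ) (segs : List (List (Fin n)))
    (r : ℕ) (x : Fin n) : Prop :=
  segs.length = r ∧ 0 < r ∧
  (∀ i, i + 1 < r → suppOf (segs.getD i []) = hull Λ (suppOf (segs.getD (i+1) []))) ∧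
  suppOf (segs.getD (r-1) []) = upSet Λ x

/-- `S ∼ S_{r,x}`, the principal `(+)`-admissible sequence of size `r` with
`Supp S_r = ⟨x⟩`. -/
def IsPrincipalSeq {n : ℕ} (Λ : Fin n → Fin n → ℕ) (r : ℕ) (x : Fin n)
    (S : List (Fin n)) : Prop :=
  ∃ segs, Segments Λ S segs ∧ PrincipalSegs Λ segs r x

/-- `S` is a principal `(+)`-admissible sequence. -/
def IsPrincipal {n : ℕ} (Λ : Fin n → Fin n → ℕ) (S : List (Fin n)) : Prop :=
  ∃ r x, IsPrincipalSeq Λ r x S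


/-! ## Representations of `(Γ, Λ)` over a field `k`. -/

/-- A (finite-dimensional) representation of the quiver `(Γ, Λ)` over `k`:
the space at vertex `x` is `Fin (d x) → k`, and each arrow carries a linear map. -/
structure Rep (k : Type) [Field k] (n : ℕ) (Λ : Fin n → Fin n → ℕ) where
  d : Fin n → ℕ
  f : ∀ a b : Fin n, Fin (Λ a b) → ((Fin (d a) → k) →ₗ[k] (Fin (d b) → k))

variable {k : Type} [Field k] {n : ℕ}

/-- A morphism of representations. -/
structure RepHom {Λ : Fin n → Fin n → ℕ} (M N : Rep k n Λ) where
  g : ∀ x, (Fin (M.d x) → k) →ₗ[k] (Fin (N.d x) → k)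
  comm : ∀ a b i v, g b (M.f a b i v) = N.f a b i (g a v)

/-- Isomorphism of representations. -/
def RepIso {Λ : Fin n → Fin n → ℕ} (M N : Rep k n Λ) : Prop :=
  ∃ g : ∀ x, (Fin (M.d x) → k) ≃ₗ[k] (Fin (N.d x) → k),
    ∀ a b i v, g b (M.f a b i v) = N.f a b i (g a v)

/-- The zero representation. -/
def IsZeroRep {Λ : Fin n → Fin n → ℕ} (M : Rep k n Λ) : Prop := ∀ x, M.d x = 0

/-- Cast between the standard spaces. -/
def castL (k : Type) [Field k] {m m' : ℕ} (h : m = m') : (Fin m → k) ≃ₗ[k] (Fin m' → k) :=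
  LinearEquiv.funCongrLeft k k (finCongr h.symm)

/-- The splitting `(Fin (m + p) → k) ≃ₗ (Fin m → k) × (Fin p → k)`. -/
def splitL (k : Type) [Field k] (m p : ℕ) : (Fin (m + p) → k) ≃ₗ[k] (Fin m → k) × (Fin p → k) :=
  (LinearEquiv.funCongrLeft k k finSumFinEquiv).trans
    (LinearEquiv.sumArrowLequivProdArrow _ _ k k)

/-- Direct sum of two representations. -/
def dSum {Λ : Fin n → Fin n → ℕ} (M N : Rep k n Λ) : Rep k n Λ where
  d x := M.d x + N.d x
  f a b i :=
    (splitL k (M.d b) (N.d b)).symm.toLinearMap ∘ₗ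
      (LinearMap.prodMap (M.f a b i) (N.f a b i)) ∘ₗ (splitL k (M.d a) (N.d a)).toLinearMap

/-- The zero representation (as an object). -/
def zeroRep (k : Type) [Field k] (n : ℕ) (Λ : Fin n → Fin n → ℕ) : Rep k n Λ where
  d _ := 0
  f _ _ _ := 0

/-- Direct sum of a list of representations. -/
def dSumList {Λ : Fin n → Fin n → ℕ} (L : List (Rep k n Λ)) : Rep k n Λ :=
  L.foldr dSum (zeroRep k n Λ)

/-- `M` is indecomposable. -/
def Indecomp {Λ : Fin n → Fin n → ℕ} (M : Rep k n Λ) : Prop :=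
  ¬ IsZeroRep M ∧ ∀ A B : Rep k n Λ, RepIso M (dSum A B) → IsZeroRep A ∨ IsZeroRep B

/-- `X` is a direct summand of `M`. -/
def IsSummand {Λ : Fin n → Fin n → ℕ} (X M : Rep k n Λ) : Prop :=
  ∃ Y, RepIso M (dSum X Y)

/-! ### Reflection functors (on objects) -/

/-- Index type of the arrows ending at `x`. -/
abbrev Arin {n : ℕ} (Λ : Fin n → Fin n → ℕ) (x : Fin n) := Σ y : Fin n, Fin (Λ y x)

/-- Index type of the arrows starting at `x`. -/
abbrev Aout {n : ℕ} (Λ : Fin n → Fin n → ℕ) (x : Fin n) := Σ y : Fin n, Fin (Λ x y)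

/-- The map `h : ⊕_{a : y → x} V(y) → V(x)` induced by the maps along the arrows ending at `x`. -/
noncomputable def inMap (Λ : Fin n → Fin n → ℕ) (M : Rep k n Λ) (x : Fin n) :
    ((p : Arin Λ x) → (Fin (M.d p.1) → k)) →ₗ[k] (Fin (M.d x) → k) :=
  ∑ p : Arin Λ x, (M.f p.1 x p.2) ∘ₗ LinearMap.proj p

/-- The map `h' : V(x) → ⊕_{a : x → y} V(y)` induced by the maps along arrows starting at `x`. -/
def outMap (Λ : Fin n → Fin n → ℕ) (M : Rep k n Λ) (x : Fin n) :
    (Fin (M.d x) → k) →ₗ[k] ((p : Aout Λ x) → (Fin (M.d p.1) → k)) :=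
  LinearMap.pi fun p => M.f x p.1 p.2

noncomputable def kerEquiv (Λ : Fin n → Fin n → ℕ) (M : Rep k n Λ) (x : Fin n) :
    LinearMap.ker (inMap Λ M x) ≃ₗ[k]
      (Fin (Module.finrank k (LinearMap.ker (inMap Λ M x))) → k) :=
  (Module.finBasis k _).equivFun

noncomputable def cokerEquiv (Λ : Fin n → Fin n → ℕ) (M : Rep k n Λ) (x : Fin n) :
    (((p : Aout Λ x) → (Fin (M.d p.1) → k)) ⧸ LinearMap.range (outMap Λ M x)) ≃ₗ[k]
      (Fin (Module.finrank k (((p : Aout Λ x) → (Fin (M.d p.1) → k)) ⧸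
        LinearMap.range (outMap Λ M x))) → k) :=
  (Module.finBasis k _).equivFun

/-- The positive reflection functor `F_x⁺` (on objects): the space at `x` is replaced
by the kernel of `inMap`, with the maps along the reversed arrows induced by inclusion
followed by the projections. -/
noncomputable def reflPlus (x : Fin n) (Λ : Fin n → Fin n → ℕ) (M : Rep k n Λ) :
    Rep k n (flipO x Λ) where
  d z := if z = x then Module.finrank k (LinearMap.ker (inMap Λ M x)) else M.d z
  f a b i :=
    if ha : a = x then
      if hb : b = x then 0
      else
        (castL k (if_neg hb).symm).toLinearMap ∘ₗ
          (LinearMap.proj (φ := fun p : Arin Λ x => Fin (M.d p.1) → k)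
            (⟨b, Fin.cast (by subst ha; simp [flipO]) i⟩ : Arin Λ x)) ∘ₗ
          (LinearMap.ker (inMap Λ M x)).subtype ∘ₗ
          (kerEquiv Λ M x).symm.toLinearMap ∘ₗ (castL k (if_pos ha)).toLinearMap
    else
      if hb : b = x then 0
      else
        (castL k (if_neg hb).symm).toLinearMap ∘ₗ
          M.f a b (Fin.cast (by simp [flipO, ha, hb]) i) ∘ₗ
          (castL k (if_neg ha)).toLinearMap

/-- The negative reflection functor `F_x⁻` (on objects), presented as a map from
representations of `(Γ, σ_x Λ)` to representations of `(Γ, Λ)`: the space at `x` is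
replaced by the cokernel of `outMap`. -/
noncomputable def reflMinus (x : Fin n) (Λ : Fin n → Fin n → ℕ)
    (N : Rep k n (flipO x Λ)) : Rep k n Λ where
  d z := if z = x then
      Module.finrank k (((p : Aout (flipO x Λ) x) → (Fin (N.d p.1) → k)) ⧸
        LinearMap.range (outMap (flipO x Λ) N x))
    else N.d z
  f a b i :=
    if hb : b = x then
      if ha : a = x then 0
      else
        (castL k (if_pos hb).symm).toLinearMap ∘ₗ
          (cokerEquiv (flipO x Λ) N x).toLinearMap ∘ₗ
          (LinearMap.range (outMap (flipO x Λ) N x)).mkQ ∘ₗ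
          (LinearMap.single k (fun p : Aout (flipO x Λ) x => Fin (N.d p.1) → k)
            (⟨a, Fin.cast (by subst hb; simp [flipO]) i⟩ : Aout (flipO x Λ) x)) ∘ₗ
          (castL k (if_neg ha)).toLinearMap
    else
      if ha : a = x then 0
      else
        (castL k (if_neg hb).symm).toLinearMap ∘ₗ
          N.f a b (Fin.cast (by simp [flipO, ha, hb]) i) ∘ₗ
          (castL k (if_neg ha)).toLinearMap

/-- `F(S) = F_{x_s}⁺ ⋯ F_{x_1}⁺` applied to a representation. -/
noncomputable def FList : (S : List (Fin n)) → (Λ : Fin n → Fin n → ℕ) → Rep k n Λ →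
    Rep k n (orientAfter Λ S)
  | [], _, M => M
  | x :: xs, Λ, M => FList xs (flipO x Λ) (reflPlus x Λ M)

/-- `S` annihilates `M` : `F(S) M = 0`. -/
def Annihilates (Λ : Fin n → Fin n → ℕ) (S : List (Fin n)) (M : Rep k n Λ) : Prop :=
  IsZeroRep (FList S Λ M)

/-- `M` is preprojective: some `(+)`-admissible sequence annihilates it. -/
def Preprojective (Λ : Fin n → Fin n → ℕ) (M : Rep k n Λ) : Prop :=
  ∃ S, Admissible Λ S ∧ Annihilates Λ S M

/-- `S` is a shortest `(+)`-admissible sequence annihilating `M` : it annihilates `M` and no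
proper subsequence of `S` annihilates `M`.  (This predicate is invariant under `∼`, so it
expresses `S ∼ S_M`.) -/
def IsShortestAnn (Λ : Fin n → Fin n → ℕ) (M : Rep k n Λ) (S : List (Fin n)) : Prop :=
  Admissible Λ S ∧ Annihilates Λ S M ∧
  ∀ S', Admissible Λ S' → Annihilates Λ S' M → Preceq Λ S' S → Sim (edges Λ) S' S

/-- The simple representation `L_x` concentrated at the vertex `x`. -/
def simpleRep (Λ : Fin n → Fin n → ℕ) (x : Fin n) : Rep k n Λ where
  d z := if z = x then 1 else 0
  f _ _ _ := 0

/-- `M(S) = F_{x₁}⁻ F_{x₂}⁻ ⋯ F_{x_{s-1}}⁻ (L_{x_s})`, where `L_{x_s}` is the simple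
(projective) module over `k(Γ, σ_{x_{s-1}} ⋯ σ_{x_1} Λ)` at the vertex `x_s`. -/
noncomputable def Mof : (Λ : Fin n → Fin n → ℕ) → (S : List (Fin n)) → Rep k n Λ
  | Λ, [] => zeroRep k n Λ
  | Λ, [x] => simpleRep Λ x
  | Λ, x :: y :: ys => reflMinus x Λ (Mof (flipO x Λ) (y :: ys))

variable {n : ℕ}

/-! ## The Weyl group -/

/-- The simple reflection `σ_i` attached to a generalized Cartan matrix `A`,
as a linear endomorphism of `ℤⁿ` : `σ_i(v) = v - (∑ l, a_{il} v_l) e_i`. -/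
def sigmaL (A : Fin n → Fin n → ℤ) (i : Fin n) : (Fin n → ℤ) →ₗ[ℤ] (Fin n → ℤ) where
  toFun v := v - (∑ l, A i l * v l) • Pi.single i 1
  map_add' v w := by
    simp only [Pi.add_apply, mul_add, Finset.sum_add_distrib, add_smul]
    abel
  map_smul' c v := by
    simp only [Pi.smul_apply, smul_eq_mul, RingHom.id_apply, smul_sub]
    congr 1
    rw [smul_smul, Finset.mul_sum]
    congr 1
    exact Finset.sum_congr rfl fun l _ => by ring

theorem sigma_invol (A : Fin n → Fin n → ℤ) (hA : ∀ i, A i i = 2) (i : Fin n) :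
    (sigmaL A i).comp (sigmaL A i) = LinearMap.id := by
  apply LinearMap.ext
  intro v
  simp only [LinearMap.comp_apply, LinearMap.id_apply, sigmaL, LinearMap.coe_mk, AddHom.coe_mk]
  set c := ∑ l, A i l * v l with hc
  set s : Fin n → ℤ := Pi.single i 1 with hs
  have h1 : ∑ l, A i l * (v - c • s) l = -c := by
    have h2 : ∀ l, A i l * (v - c • s) l = A i l * v l - c * (A i l * s l) := fun l => by
      simp only [Pi.sub_apply, Pi.smul_apply, smul_eq_mul]
      ring
    rw [Finset.sum_congr rfl fun l _ => h2 l, Finset.sum_sub_distrib, ← Finset.mul_sum]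
    have h3 : ∑ l, A i l * s l = 2 := by
      rw [Finset.sum_eq_single i]
      · simp [hs, hA i]
      · intro b _ hb
        simp [hs, Pi.single_eq_of_ne hb]
      · simp
    rw [h3, ← hc]
    ring
  rw [h1]
  ext j
  simp only [Pi.sub_apply, Pi.smul_apply, smul_eq_mul]
  ring

/-- The simple reflection `σ_i` as an automorphism of `ℤⁿ`. -/
def sigmaE (A : Fin n → Fin n → ℤ) (hA : ∀ i, A i i = 2) (i : Fin n) :
    (Fin n → ℤ) ≃ₗ[ℤ] (Fin n → ℤ) :=
  LinearEquiv.ofLinear (sigmaL A i) (sigmaL A i) (sigma_invol A hA i) (sigma_invol A hA i)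

/-- The length `ℓ(w)`: the least `l ≥ 0` such that `w` is a product of `l` simple
reflections. -/
noncomputable def wordLen (A : Fin n → Fin n → ℤ) (hA : ∀ i, A i i = 2)
    (w : (Fin n → ℤ) ≃ₗ[ℤ] (Fin n → ℤ)) : ℕ :=
  sInf {l | ∃ ys : List (Fin n), ys.length = l ∧ w = (ys.map (sigmaE A hA)).prod}

/-- The word `w(S) = σ_{x_s} ⋯ σ_{x_1}` associated to a sequence `S = x₁, …, x_s`. -/
def wordOf (A : Fin n → Fin n → ℤ) (hA : ∀ i, A i i = 2) (S : List (Fin n)) :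
    (Fin n → ℤ) ≃ₗ[ℤ] (Fin n → ℤ) :=
  ((S.reverse).map (sigmaE A hA)).prod

/-- The symmetric generalized Cartan matrix of the underlying graph of `(Γ, Λ)`. -/
def cartanOf (Λ : Fin n → Fin n → ℕ) : Fin n → Fin n → ℤ :=
  fun i j => if i = j then 2 else -(edges Λ i j : ℤ)

theorem cartan_diag (Λ : Fin n → Fin n → ℕ) : ∀ i, cartanOf Λ i i = 2 := by
  intro i; simp [cartanOf]

/-- The simple reflections of the Weyl group of the underlying graph of `(Γ, Λ)`. -/
def wSig (Λ : Fin n → Fin n → ℕ) : Fin n → ((Fin n → ℤ) ≃ₗ[ℤ] (Fin n → ℤ)) :=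
  sigmaE (cartanOf Λ) (cartan_diag Λ)

/-- `w(S)` for a sequence of vertices of `(Γ, Λ)`. -/
def wordOfSeq (Λ : Fin n → Fin n → ℕ) (S : List (Fin n)) :
    (Fin n → ℤ) ≃ₗ[ℤ] (Fin n → ℤ) :=
  ((S.reverse).map (wSig Λ)).prod

/-- The word `w(S)` is reduced: `ℓ(w(S))` equals the number of letters of `S`. -/
noncomputable def IsReducedSeq (Λ : Fin n → Fin n → ℕ) (S : List (Fin n)) : Prop :=
  wordLen (cartanOf Λ) (cartan_diag Λ) (wordOfSeq Λ S) = S.length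

/-! ## Dynkin graphs of types A, D, E -/

def edgeA (n : ℕ) : Fin n → Fin n → ℕ := fun i j =>
  if (i : ℕ) + 1 = (j : ℕ) ∨ (j : ℕ) + 1 = (i : ℕ) then 1 else 0

def edgeD (n : ℕ) : Fin n → Fin n → ℕ := fun i j =>
  if ((i : ℕ) = 0 ∧ (j : ℕ) = 2) ∨ ((j : ℕ) = 0 ∧ (i : ℕ) = 2) ∨
     ((i : ℕ) = 1 ∧ (j : ℕ) = 2) ∨ ((j : ℕ) = 1 ∧ (i : ℕ) = 2) ∨
     (2 ≤ (i : ℕ) ∧ (i : ℕ) + 1 = (j : ℕ)) ∨ (2 ≤ (j : ℕ) ∧ (j : ℕ) + 1 = (i : ℕ))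
  then 1 else 0

def edgeE (n : ℕ) : Fin n → Fin n → ℕ := fun i j =>
  if ((i : ℕ) + 1 = (j : ℕ) ∧ (j : ℕ) ≤ n - 2) ∨ ((j : ℕ) + 1 = (i : ℕ) ∧ (i : ℕ) ≤ n - 2) ∨
     ((i : ℕ) = 2 ∧ (j : ℕ) = n - 1) ∨ ((j : ℕ) = 2 ∧ (i : ℕ) = n - 1)
  then 1 else 0

/-- The underlying graph (given by its edge-count function `E`) is a Dynkin diagram of
type `A`, `D`, or `E`. -/
def IsDynkinADE (n : ℕ) (E : Fin n → Fin n → ℕ) : Prop :=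
  ∃ e : Fin n ≃ Fin n,
    (∀ i j, E i j = edgeA n (e i) (e j)) ∨
    (4 ≤ n ∧ ∀ i j, E i j = edgeD n (e i) (e j)) ∨
    ((n = 6 ∨ n = 7 ∨ n = 8) ∧ ∀ i j, E i j = edgeE n (e i) (e j))

/-! ## Coxeter-sortable elements -/

/-- Lexicographic comparison of index tuples. -/
def lexLE {s : ℕ} (ι ι' : Fin s → ℕ) : Prop :=
  ι = ι' ∨ ∃ j, (∀ j', j' < j → ι j' = ι' j') ∧ ι j < ι' j

/-- `w` is `c`-sortable for the Coxeter element determined by the half-infinite word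
`cseq` (with dividers every `blockLen` letters): the lexicographically first subsequence
of `cseq` that is a reduced word for `w` defines a sequence of subsets (between adjacent
dividers) that is decreasing under inclusion. -/
def CSortable (A : Fin n → Fin n → ℤ) (hA : ∀ i, A i i = 2) (cseq : ℕ → Fin n)
    (blockLen : ℕ) (w : (Fin n → ℤ) ≃ₗ[ℤ] (Fin n → ℤ)) : Prop :=
  ∃ (s : ℕ) (ι : Fin s → ℕ), StrictMono ι ∧
    w = ((List.ofFn fun j => cseq (ι j)).map (sigmaE A hA)).prod ∧
    wordLen A hA w = s ∧
    (∀ ι' : Fin s → ℕ, StrictMono ι' →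
      w = ((List.ofFn fun j => cseq (ι' j)).map (sigmaE A hA)).prod → lexLE ι ι') ∧
    ∀ m : ℕ, {a : Fin n | ∃ j, (ι j) / blockLen = m + 1 ∧ cseq (ι j) = a} ⊆
             {a : Fin n | ∃ j, (ι j) / blockLen = m ∧ cseq (ι j) = a}


/-- A nonzero non-isomorphism between representations. -/
def RepStep {k : Type} [Field k] {n : ℕ} {Λ : Fin n → Fin n → ℕ} (X Y : Rep k n Λ) : Prop :=
  ∃ f : RepHom X Y, (∃ x v, f.g x v ≠ 0) ∧ ¬ ∀ x, Function.Bijective (f.g x)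

/-- `v` is a minimal element of `D` in the poset `(Γ₀, Λ)`. -/
def MinimalIn {n : ℕ} (Λ : Fin n → Fin n → ℕ) (D : Set (Fin n)) (v : Fin n) : Prop :=
  v ∈ D ∧ ∀ u ∈ D, PathLE Λ u v → u = v

/-- The pairs `(h, v)` of Proposition 3.2(a): `0 < h ≤ r` and `v` a minimal element of
`Supp S_h \ H_Λ(Supp S_{h+1})` (with `Supp S_{r+1} = ∅`). -/
def JoinPair {n : ℕ} (Λ : Fin n → Fin n → ℕ) (segs : List (List (Fin n)))
    (p : ℕ × Fin n) : Prop :=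
  0 < p.1 ∧ p.1 ≤ segs.length ∧
  MinimalIn Λ (suppOf (segs.getD (p.1 - 1) []) \ hull Λ (suppOf (segs.getD p.1 []))) p.2

/-! ## Proof of the theorem -/

section Proof

/-- Identity morphism. -/
def homId {Λ : Fin n → Fin n → ℕ} (M : Rep k n Λ) : RepHom M M :=
  ⟨fun _ => LinearMap.id, fun _ _ _ _ => rfl⟩

/-- Zero morphism. -/
def homZero {Λ : Fin n → Fin n → ℕ} (M N : Rep k n Λ) : RepHom M N :=
  ⟨fun _ => 0, fun _ _ _ _ => by simp⟩

/-- Composition of morphisms. -/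
def homComp {Λ : Fin n → Fin n → ℕ} {M N P : Rep k n Λ} (h : RepHom N P) (g : RepHom M N) :
    RepHom M P :=
  ⟨fun x => h.g x ∘ₗ g.g x, fun a b i v => by simp [g.comm, h.comm]⟩

theorem exists_subRep {Λ : Fin n → Fin n → ℕ} (M : Rep k n Λ)
    (W : ∀ z, Submodule k (Fin (M.d z) → k))
    (hW : ∀ a b i, ∀ v ∈ W a, M.f a b i v ∈ W b) :
    ∃ (A : Rep k n Λ) (i : RepHom A M), (∀ z, Function.Injective (i.g z)) ∧
      ∀ z, LinearMap.range (i.g z) = W z := by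
  let e : ∀ z, W z ≃ₗ[k] (Fin (Module.finrank k (W z)) → k) := fun z =>
    (Module.finBasis k (W z)).equivFun
  refine ⟨⟨fun z => Module.finrank k (W z), fun a b i =>
    (e b).toLinearMap ∘ₗ (M.f a b i).restrict (hW a b i) ∘ₗ (e a).symm.toLinearMap⟩,
    ⟨fun z => (W z).subtype ∘ₗ (e z).symm.toLinearMap, ?_⟩, ?_, ?_⟩
  · intro a b i v
    simp
  · intro z
    exact (Subtype.val_injective).comp (e z).symm.injective
  · intro z
    rw [LinearMap.range_comp, LinearEquiv.range, Submodule.map_top, Submodule.range_subtype]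

/-- The splitting of the spaces of a direct sum. -/
def spl {Λ : Fin n → Fin n → ℕ} (A B : Rep k n Λ) (z : Fin n) :
    (Fin ((dSum A B).d z) → k) ≃ₗ[k] (Fin (A.d z) → k) × (Fin (B.d z) → k) :=
  splitL k (A.d z) (B.d z)

theorem spl_dSum {Λ : Fin n → Fin n → ℕ} (A B : Rep k n Λ) (a b : Fin n) (l : Fin (Λ a b))
    (w : Fin ((dSum A B).d a) → k) :
    spl A B b ((dSum A B).f a b l w) = (A.f a b l (spl A B a w).1, B.f a b l (spl A B a w).2) :=
  (splitL k (A.d b) (B.d b)).apply_symm_apply _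

theorem iso_dSum {Λ : Fin n → Fin n → ℕ} {M A B : Rep k n Λ} (i : RepHom A M) (j : RepHom B M)
    (hb : ∀ z, Function.Bijective (LinearMap.coprod (i.g z) (j.g z))) :
    RepIso M (dSum A B) := by
  let e : ∀ z, (Fin ((dSum A B).d z) → k) ≃ₗ[k] (Fin (M.d z) → k) := fun z =>
    (spl A B z).trans (LinearEquiv.ofBijective _ (hb z))
  have he : ∀ z w, e z w = i.g z (spl A B z w).1 +
      j.g z (spl A B z w).2 := fun _ _ => rfl
  refine ⟨fun z => (e z).symm, ?_⟩
  intro a b l v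
  obtain ⟨w, rfl⟩ := (e a).surjective v
  rw [LinearEquiv.symm_apply_eq, LinearEquiv.symm_apply_apply]
  rw [he, he, spl_dSum, i.comm, j.comm, map_add]

theorem finpi_eq_zero {m : ℕ} (h : ∀ v : Fin m → k, v = 0) : m = 0 := by
  by_contra hm
  have := congrFun (h (fun _ => 1)) ⟨0, Nat.pos_of_ne_zero hm⟩
  simp at this

/-- Idempotent endomorphisms of an indecomposable are trivial. -/
theorem idem_trivial {Λ : Fin n → Fin n → ℕ} {M : Rep k n Λ} (hM : Indecomp M)
    (e : RepHom M M) (he : ∀ z v, e.g z (e.g z v) = e.g z v) :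
    (∀ z v, e.g z v = 0) ∨ (∀ z v, e.g z v = v) := by
  obtain ⟨A, i, hi, hir⟩ := exists_subRep M (fun z => LinearMap.range (e.g z)) (by
    rintro a b l _ ⟨v, rfl⟩
    exact ⟨M.f a b l v, e.comm a b l v⟩)
  obtain ⟨B, j, hj, hjr⟩ := exists_subRep M (fun z => LinearMap.ker (e.g z)) (by
    intro a b l v hv
    rw [LinearMap.mem_ker] at hv ⊢
    rw [e.comm, hv, map_zero])
  have hiv : ∀ z v, e.g z (i.g z v) = i.g z v := by
    intro z v
    have : i.g z v ∈ LinearMap.range (e.g z) := hir z ▸ ⟨v, rfl⟩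
    obtain ⟨w, hw⟩ := this
    rw [← hw, he]
  have hjv : ∀ z v, e.g z (j.g z v) = 0 := by
    intro z v
    have : j.g z v ∈ LinearMap.ker (e.g z) := hjr z ▸ ⟨v, rfl⟩
    exact this
  have hiso : RepIso M (dSum A B) := by
    refine iso_dSum i j fun z => ⟨?_, ?_⟩
    · rw [injective_iff_map_eq_zero]
      rintro ⟨a, b⟩ hab
      simp only [LinearMap.coprod_apply] at hab
      have h1 := congrArg (e.g z) hab
      rw [map_add, hiv, hjv, add_zero, map_zero] at h1
      rw [h1, zero_add] at hab
      rw [← map_zero (i.g z)] at h1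
      rw [← map_zero (j.g z)] at hab
      rw [hi z h1, hj z hab]
      rfl
    · intro v
      have h1 : e.g z v ∈ LinearMap.range (i.g z) := hir z ▸ ⟨v, rfl⟩
      have h2 : v - e.g z v ∈ LinearMap.range (j.g z) := by
        rw [hjr z, LinearMap.mem_ker, map_sub, he, sub_self]
      obtain ⟨a, ha⟩ := h1
      obtain ⟨b, hb⟩ := h2
      exact ⟨(a, b), by simp [ha, hb]⟩
  rcases hM.2 A B hiso with h | h
  · left
    intro z v
    have h1 : e.g z v ∈ LinearMap.range (i.g z) := hir z ▸ ⟨v, rfl⟩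
    obtain ⟨a, ha⟩ := h1
    have : a = 0 := by
      ext t
      exact (Fin.cast (h z) t).elim0
    rw [← ha, this, map_zero]
  · right
    intro z v
    have h2 : v - e.g z v ∈ LinearMap.range (j.g z) := by
      rw [hjr z, LinearMap.mem_ker, map_sub, he, sub_self]
    obtain ⟨a, ha⟩ := h2
    have : a = 0 := by
      ext t
      exact (Fin.cast (h z) t).elim0
    rw [this, map_zero] at ha
    exact (sub_eq_zero.mp ha.symm).symm

/-- Converse: if idempotents are trivial then a nonzero representation is indecomposable. -/
theorem indecomp_of_idem {Λ : Fin n → Fin n → ℕ} {M : Rep k n Λ} (h0 : ¬ IsZeroRep M)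
    (H : ∀ e : RepHom M M, (∀ z v, e.g z (e.g z v) = e.g z v) →
      (∀ z v, e.g z v = 0) ∨ (∀ z v, e.g z v = v)) : Indecomp M := by
  refine ⟨h0, ?_⟩
  rintro A B ⟨g, hg⟩
  let c : ∀ z, (Fin (M.d z) → k) ≃ₗ[k] (Fin (A.d z) → k) × (Fin (B.d z) → k) := fun z =>
    (g z).trans (spl A B z)
  have hc : ∀ a b i v, c b (M.f a b i v) =
      (A.f a b i (c a v).1, B.f a b i (c a v).2) := by
    intro a b i v
    change spl A B b (g b (M.f a b i v)) = _
    rw [hg, spl_dSum]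
    rfl
  let e : RepHom M M := ⟨fun z => (c z).symm.toLinearMap ∘ₗ
      (LinearMap.inl k _ _ ∘ₗ LinearMap.fst k _ _) ∘ₗ (c z).toLinearMap, by
    intro a b i v
    apply (c b).injective
    simp [hc]⟩
  have key := H e (by intro z v; simp [e])
  rcases key with h | h
  · left
    intro z
    refine finpi_eq_zero (k := k) fun v => ?_
    have := h z ((c z).symm (v, 0))
    simpa [e] using this
  · right
    intro z
    refine finpi_eq_zero (k := k) fun v => ?_
    have := h z ((c z).symm (0, v))
    simpa [e, eq_comm] using this

/-- Comparison of the spaces of `M` and `F_x⁺ M` away from `x`. -/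
noncomputable def cc (x : Fin n) (Λ : Fin n → Fin n → ℕ) (M : Rep k n Λ) (z : Fin n) (hz : z ≠ x) :
    (Fin ((reflPlus x Λ M).d z) → k) ≃ₗ[k] (Fin (M.d z) → k) :=
  castL k (if_neg hz)

theorem castL_castL {m m' : ℕ} (h : m = m') (h' : m' = m) (v : Fin m → k) :
    castL k h' (castL k h v) = v := by
  subst h
  rfl

theorem flip_off {x a b : Fin n} (Λ : Fin n → Fin n → ℕ) (ha : a ≠ x) (hb : b ≠ x) :
    Λ a b = flipO x Λ a b := by simp [flipO, ha, hb]

theorem flip_at (x b : Fin n) (Λ : Fin n → Fin n → ℕ) :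
    Λ b x = flipO x Λ x b := by simp [flipO]

theorem cc_f (x : Fin n) (Λ : Fin n → Fin n → ℕ) (M : Rep k n Λ) (a b : Fin n)
    (ha : a ≠ x) (hb : b ≠ x) (i : Fin (Λ a b)) (v) :
    cc x Λ M b hb ((reflPlus x Λ M).f a b (Fin.cast (flip_off Λ ha hb) i) v) =
      M.f a b i (cc x Λ M a ha v) := by
  have h : (reflPlus x Λ M).f a b (Fin.cast (flip_off Λ ha hb) i) =
      (castL k (if_neg hb).symm).toLinearMap ∘ₗ M.f a b i ∘ₗ
        (castL k (if_neg ha)).toLinearMap :=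
    (dif_neg ha).trans (dif_neg hb)
  rw [h]
  exact castL_castL (if_neg hb).symm (if_neg hb) _

/-- The inclusion of the kernel. -/
noncomputable def iota (x : Fin n) (Λ : Fin n → Fin n → ℕ) (M : Rep k n Λ) :
    (Fin ((reflPlus x Λ M).d x) → k) ≃ₗ[k] LinearMap.ker (inMap Λ M x) :=
  (castL k (if_pos rfl)).trans (kerEquiv Λ M x).symm

theorem cc_iota (x : Fin n) (Λ : Fin n → Fin n → ℕ) (M : Rep k n Λ) (b : Fin n)
    (hb : b ≠ x) (i : Fin (Λ b x)) (v) :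
    cc x Λ M b hb ((reflPlus x Λ M).f x b (Fin.cast (flip_at x b Λ) i) v) =
      (iota x Λ M v).1 ⟨b, i⟩ := by
  have h : (reflPlus x Λ M).f x b (Fin.cast (flip_at x b Λ) i) =
      (castL k (if_neg hb).symm).toLinearMap ∘ₗ
          (LinearMap.proj (φ := fun p : Arin Λ x => Fin (M.d p.1) → k)
            (⟨b, i⟩ : Arin Λ x)) ∘ₗ
          (LinearMap.ker (inMap Λ M x)).subtype ∘ₗ
          (kerEquiv Λ M x).symm.toLinearMap ∘ₗ (castL k (if_pos rfl)).toLinearMap :=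
    (dif_pos rfl).trans (dif_neg hb)
  rw [h]
  exact castL_castL (if_neg hb).symm (if_neg hb) _

theorem inMap_apply (Λ : Fin n → Fin n → ℕ) (M : Rep k n Λ) (x : Fin n) (w) :
    inMap Λ M x w = ∑ p : Arin Λ x, M.f p.1 x p.2 (w p) := by
  simp [inMap]

theorem arin_ne {Λ : Fin n → Fin n → ℕ} {x : Fin n} (hx : IsSink Λ x) (p : Arin Λ x) :
    p.1 ≠ x := by
  rintro h
  have h1 := p.2.pos
  rw [h, hx x] at h1
  exact absurd h1 (lt_irrefl 0)

/-- Lifting morphisms from `F_x⁺ M → F_x⁺ N` to `M → N`. -/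
theorem lift_hom {Λ : Fin n → Fin n → ℕ} {x : Fin n} (hx : IsSink Λ x) {M N : Rep k n Λ}
    (hs : Function.Surjective (inMap Λ M x))
    (h : RepHom (reflPlus x Λ M) (reflPlus x Λ N)) :
    ∃ g : RepHom M N, ∀ z (hz : z ≠ x) v,
      g.g z (cc x Λ M z hz v) = cc x Λ N z hz (h.g z v) := by
  let g0 : ∀ z, z ≠ x → ((Fin (M.d z) → k) →ₗ[k] (Fin (N.d z) → k)) := fun z hz =>
    (cc x Λ N z hz).toLinearMap ∘ₗ h.g z ∘ₗ (cc x Λ M z hz).symm.toLinearMap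
  let G : ((p : Arin Λ x) → (Fin (M.d p.1) → k)) →ₗ[k] ((p : Arin Λ x) → (Fin (N.d p.1) → k)) :=
    LinearMap.pi fun p => g0 p.1 (arin_ne hx p) ∘ₗ LinearMap.proj p
  have hker : LinearMap.ker (inMap Λ M x) ≤ LinearMap.ker (inMap Λ N x ∘ₗ G) := by
    intro w hw
    obtain ⟨u, hu⟩ := (iota x Λ M).surjective ⟨w, hw⟩
    have hG : G w = (iota x Λ N (h.g x u)).1 := by
      ext1 p
      obtain ⟨b, i⟩ := p
      have hb : b ≠ x := arin_ne hx ⟨b, i⟩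
      have hw' : w = (iota x Λ M u).1 := by rw [hu]
      rw [← cc_iota x Λ N b hb i, ← h.comm]
      simp only [G, g0, LinearMap.pi_apply, LinearMap.comp_apply, LinearMap.proj_apply,
        LinearEquiv.coe_coe, hw']
      rw [← cc_iota x Λ M b hb i, LinearEquiv.symm_apply_apply]
    rw [LinearMap.mem_ker, LinearMap.comp_apply, hG]
    exact (iota x Λ N (h.g x u)).2
  obtain ⟨gx, hgx⟩ : ∃ gx : (Fin (M.d x) → k) →ₗ[k] (Fin (N.d x) → k),
      ∀ w, gx (inMap Λ M x w) = inMap Λ N x (G w) := by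
    let q := (inMap Λ M x).quotKerEquivOfSurjective hs
    refine ⟨(LinearMap.ker (inMap Λ M x)).liftQ (inMap Λ N x ∘ₗ G) hker ∘ₗ
      q.symm.toLinearMap, fun w => ?_⟩
    have : q.symm (inMap Λ M x w) = Submodule.Quotient.mk w := by
      rw [LinearEquiv.symm_apply_eq]
      rfl
    rw [LinearMap.comp_apply, LinearEquiv.coe_coe, this]
    rfl
  classical
  let g : ∀ z, (Fin (M.d z) → k) →ₗ[k] (Fin (N.d z) → k) := fun z =>
    if hz : z = x then Eq.rec (motive := fun z _ => (Fin (M.d z) → k) →ₗ[k] (Fin (N.d z) → k))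
      gx hz.symm else g0 z hz
  have gx_eq : g x = gx := by simp [g]
  have g_eq : ∀ z (hz : z ≠ x), g z = g0 z hz := fun z hz => by simp [g, hz]
  refine ⟨⟨g, ?_⟩, ?_⟩
  · intro a b i v
    by_cases ha : a = x
    · subst ha
      exact (Fin.cast (hx b) i).elim0
    by_cases hb : b = x
    · subst hb
      rw [gx_eq, g_eq a ha]
      have h1 := hgx (Pi.single (⟨a, i⟩ : Arin Λ b) v)
      rw [inMap_apply, inMap_apply, Finset.sum_eq_single ⟨a, i⟩,
        Finset.sum_eq_single ⟨a, i⟩] at h1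
      · simpa [G] using h1
      · intro p _ hp
        simp [G, Pi.single_eq_of_ne hp]
      · simp
      · intro p _ hp
        simp [Pi.single_eq_of_ne hp]
      · simp
    · rw [g_eq a ha, g_eq b hb]
      obtain ⟨u, rfl⟩ := (cc x Λ M a ha).surjective v
      simp only [g0, LinearMap.comp_apply, LinearEquiv.coe_coe, LinearEquiv.symm_apply_apply]
      rw [← cc_f x Λ M a b ha hb i, LinearEquiv.symm_apply_apply, h.comm, cc_f]
  · intro z hz v
    change g z _ = _
    rw [g_eq z hz]
    simp [g0]

/-- Morphisms agreeing away from the sink `x` agree. -/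
theorem hom_uniq {Λ : Fin n → Fin n → ℕ} {x : Fin n} (hx : IsSink Λ x) {M N : Rep k n Λ}
    (hs : Function.Surjective (inMap Λ M x)) (g g' : RepHom M N)
    (h : ∀ z, z ≠ x → ∀ v, g.g z v = g'.g z v) : ∀ z v, g.g z v = g'.g z v := by
  intro z v
  by_cases hz : z = x
  · subst hz
    obtain ⟨w, rfl⟩ := hs v
    rw [inMap_apply, map_sum, map_sum]
    refine Finset.sum_congr rfl fun p _ => ?_
    rw [g.comm, g'.comm, h _ (arin_ne hx p)]
  · exact h z hz v

/-- Morphisms of reflected representations agreeing away from `x` agree. -/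
theorem hom_uniq' {Λ : Fin n → Fin n → ℕ} {x : Fin n} (hx : IsSink Λ x) {M N : Rep k n Λ}
    (g g' : RepHom (reflPlus x Λ M) (reflPlus x Λ N))
    (h : ∀ z, z ≠ x → ∀ v, g.g z v = g'.g z v) : ∀ z v, g.g z v = g'.g z v := by
  intro z v
  by_cases hz : z = x
  · subst hz
    apply (iota z Λ N).injective
    apply Subtype.ext
    ext1 p
    obtain ⟨b, i⟩ := p
    have hb : b ≠ z := arin_ne hx ⟨b, i⟩
    rw [← cc_iota z Λ N b hb i, ← cc_iota z Λ N b hb i, ← g.comm, ← g'.comm, h b hb]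
  · exact h z hz v

theorem refl_indecomp {Λ : Fin n → Fin n → ℕ} {x : Fin n} (hx : IsSink Λ x) {M : Rep k n Λ}
    (hM : Indecomp M) (hs : Function.Surjective (inMap Λ M x)) :
    Indecomp (reflPlus x Λ M) := by
  apply indecomp_of_idem
  · intro h0
    apply hM.1
    have h1 : ∀ z, z ≠ x → M.d z = 0 := fun z hz => by
      have := h0 z
      simpa [reflPlus, hz] using this
    intro z
    by_cases hz : z = x
    · subst hz
      refine finpi_eq_zero (k := k) fun v => ?_
      obtain ⟨w, rfl⟩ := hs v
      have : w = 0 := by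
        ext p t
        exact (Fin.cast (h1 _ (arin_ne hx p)) t).elim0
      rw [this, map_zero]
    · exact h1 z hz
  · intro e he
    obtain ⟨e', he'⟩ := lift_hom hx hs e
    have hid := hom_uniq hx hs (homComp e' e') e' (by
      intro z hz v
      obtain ⟨u, rfl⟩ := (cc x Λ M z hz).surjective v
      simp [homComp, he', he])
    rcases idem_trivial hM e' hid with h | h
    · left
      refine hom_uniq' hx e (homZero _ _) fun z hz v => ?_
      apply (cc x Λ M z hz).injective
      rw [← he', h]
      simp [homZero]
    · right
      refine hom_uniq' hx e (homId _) fun z hz v => ?_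
      apply (cc x Λ M z hz).injective
      rw [← he', h]
      simp [homId]

theorem iso_of_refl_iso {Λ : Fin n → Fin n → ℕ} {x : Fin n} (hx : IsSink Λ x) {M N : Rep k n Λ}
    (hM : Function.Surjective (inMap Λ M x)) (hN : Function.Surjective (inMap Λ N x))
    (h : RepIso (reflPlus x Λ M) (reflPlus x Λ N)) : RepIso M N := by
  obtain ⟨e, he⟩ := h
  obtain ⟨g, hg⟩ := lift_hom hx hM ⟨fun z => (e z).toLinearMap, he⟩
  obtain ⟨g', hg'⟩ := lift_hom hx hN ⟨fun z => (e z).symm.toLinearMap, by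
    intro a b i v
    obtain ⟨u, rfl⟩ := (e a).surjective v
    simp [← he]⟩
  have h1 := hom_uniq hx hM (homComp g' g) (homId M) (by
    intro z hz v
    obtain ⟨u, rfl⟩ := (cc x Λ M z hz).surjective v
    simp [homComp, homId, hg, hg'])
  have h2 := hom_uniq hx hN (homComp g g') (homId N) (by
    intro z hz v
    obtain ⟨u, rfl⟩ := (cc x Λ N z hz).surjective v
    simp [homComp, homId, hg, hg'])
  exact ⟨fun z => LinearEquiv.ofLinear (g.g z) (g'.g z) (LinearMap.ext (h2 z))
    (LinearMap.ext (h1 z)), g.comm⟩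

/-- An indecomposable for which `inMap` at the sink `x` is not onto is concentrated at `x`. -/
theorem concentrated {Λ : Fin n → Fin n → ℕ} {x : Fin n} (hx : IsSink Λ x) {M : Rep k n Λ}
    (hM : Indecomp M) (hs : ¬ Function.Surjective (inMap Λ M x)) :
    ∀ z, z ≠ x → M.d z = 0 := by
  obtain ⟨C, hC⟩ := Submodule.exists_isCompl (LinearMap.range (inMap Λ M x))
  let P : (Fin (M.d x) → k) →ₗ[k] (Fin (M.d x) → k) := C.projection (LinearMap.range (inMap Λ M x)) hC.symm
  have hP1 : ∀ v ∈ LinearMap.range (inMap Λ M x), P v = 0 := fun v hv => by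
    simp [P, Submodule.projection_apply_eq_zero_iff, hv]
  have hP2 : ∀ v, P (P v) = P v := fun v => by
    simp [P]
  have hP3 : P ≠ 0 := by
    intro h
    apply hs
    rw [← LinearMap.range_eq_top, eq_top_iff]
    intro v _
    have : P v = 0 := by rw [h]; rfl
    simpa [P, Submodule.projection_apply_eq_zero_iff] using this
  classical
  let g : ∀ z, (Fin (M.d z) → k) →ₗ[k] (Fin (M.d z) → k) := fun z =>
    if hz : z = x then Eq.rec (motive := fun z _ => (Fin (M.d z) → k) →ₗ[k] (Fin (M.d z) → k))
      P hz.symm else 0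
  have gx_eq : g x = P := by simp [g]
  have g_eq : ∀ z (hz : z ≠ x), g z = 0 := fun z hz => by simp [g, hz]
  let e : RepHom M M := ⟨g, by
    intro a b i v
    by_cases ha : a = x
    · subst ha
      exact (Fin.cast (hx b) i).elim0
    by_cases hb : b = x
    · subst hb
      rw [gx_eq, g_eq a ha, LinearMap.zero_apply, map_zero]
      apply hP1
      refine ⟨Pi.single (⟨a, i⟩ : Arin Λ b) v, ?_⟩
      rw [inMap_apply, Finset.sum_eq_single ⟨a, i⟩]
      · simp
      · intro p _ hp
        simp [Pi.single_eq_of_ne hp]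
      · simp
    · simp [g_eq a ha, g_eq b hb]⟩
  have hid : ∀ z v, e.g z (e.g z v) = e.g z v := by
    intro z v
    by_cases hz : z = x
    · subst hz
      change g z (g z v) = g z v
      rw [gx_eq, hP2]
    · change g z (g z v) = g z v
      rw [g_eq z hz]
      rfl
  rcases idem_trivial hM e hid with h | h
  · exact absurd (LinearMap.ext fun v => by rw [← gx_eq]; exact h x v) hP3
  · intro z hz
    refine finpi_eq_zero (k := k) fun v => ?_
    rw [← h z v]
    change g z v = 0
    rw [g_eq z hz]
    rfl

theorem not_surj_of_concentrated {Λ : Fin n → Fin n → ℕ} {x : Fin n} (hx : IsSink Λ x)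
    {M : Rep k n Λ} (hM : Indecomp M) (hc : ∀ z, z ≠ x → M.d z = 0) :
    ¬ Function.Surjective (inMap Λ M x) := by
  intro hs
  apply hM.1
  intro z
  by_cases hz : z = x
  · subst hz
    refine finpi_eq_zero (k := k) fun v => ?_
    obtain ⟨w, rfl⟩ := hs v
    have : w = 0 := by
      ext p t
      exact (Fin.cast (hc _ (arin_ne hx p)) t).elim0
    rw [this, map_zero]
  · exact hc z hz

theorem refl_dim {Λ : Fin n → Fin n → ℕ} {x : Fin n} {M N : Rep k n Λ}
    (hM : Function.Surjective (inMap Λ M x)) (hN : Function.Surjective (inMap Λ N x))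
    (hd : M.d = N.d) : (reflPlus x Λ M).d = (reflPlus x Λ N).d := by
  have aux : ∀ L : Rep k n Λ, Function.Surjective (inMap Λ L x) →
      L.d x + Module.finrank k (LinearMap.ker (inMap Λ L x)) = ∑ p : Arin Λ x, L.d p.1 := by
    intro L hL
    have h := LinearMap.finrank_range_add_finrank_ker (inMap Λ L x)
    rw [LinearMap.range_eq_top.mpr hL, finrank_top, Module.finrank_fin_fun] at h
    rw [h]
    refine (Module.finrank_pi_fintype k).trans (Finset.sum_congr rfl fun p _ => ?_)
    exact Module.finrank_fin_fun k
  have h1 := aux M hM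
  have h2 := aux N hN
  have h3 : ∀ z, M.d z = N.d z := congrFun hd
  have h4 : ∑ p : Arin Λ x, M.d p.1 = ∑ p : Arin Λ x, N.d p.1 :=
    Finset.sum_congr rfl fun p _ => h3 p.1
  have h5 := h3 x
  funext z
  simp only [reflPlus]
  split_ifs
  · omega
  · exact h3 z

theorem main_aux (S : List (Fin n)) : ∀ (Λ : Fin n → Fin n → ℕ) (M N : Rep k n Λ),
    Admissible Λ S → Annihilates Λ S M → Indecomp M → Indecomp N → M.d = N.d → RepIso M N := by
  induction S with
  | nil =>
    intro Λ M N _ h hM _ _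
    exact absurd h hM.1
  | cons x xs ih =>
    intro Λ M N hA h hM hN hd
    obtain ⟨hx, hA'⟩ := hA
    by_cases hs : Function.Surjective (inMap Λ M x)
    · have hsN : Function.Surjective (inMap Λ N x) := by
        by_contra hsN
        have hc := concentrated hx hN hsN
        rw [← hd] at hc
        exact not_surj_of_concentrated hx hM hc hs
      exact iso_of_refl_iso hx hs hsN (ih _ _ _ hA' h (refl_indecomp hx hM hs)
        (refl_indecomp hx hN hsN) (refl_dim hs hsN hd))
    · have hc := concentrated hx hM hs
      refine ⟨fun z => castL k (congrFun hd z), ?_⟩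
      intro a b i v
      by_cases ha : a = x
      · subst ha
        exact (Fin.cast (hx b) i).elim0
      · have : v = 0 := by
          ext t
          exact (Fin.cast (hc a ha) t).elim0
        simp [this]

end Proof

theorem dim_vector_determines_preprojective
    (n : ℕ) (hn : 2 ≤ n) (Λ : Fin n → Fin n → ℕ)
    (hloop : ∀ a, Λ a a = 0)
    (hconn : ∀ a b : Fin n, Relation.ReflTransGen (fun u v => edges Λ u v ≠ 0) a b)
    (hacyc : ∀ a : Fin n, ¬ Relation.TransGen (fun u v => Λ u v ≠ 0) a a)
    (k : Type) [Field k]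
    (M N : Rep k n Λ) (hMi : Indecomp M) (hNi : Indecomp N)
    (hMp : Preprojective Λ M) (hdim : M.d = N.d) :
    RepIso M N := by
  obtain ⟨S, hA, hS⟩ := hMp
  exact main_aux S Λ M N hA hS hMi hNi hdim

end KP
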